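/- Given incoming supersonic data (Ū₋(r₁), ρ̄₋(r₁), S̄₋, κ̄) at r = r₁ with Ū₋(r₁) > 0, ρ̄₋(r₁) > 0, S̄₋ > 0 and Ū₋²(r₁) > c²(ρ̄₋(r₁), S̄₋), there exist two positive constants P₁ < P₂, depending only on these data and on r₁, r₂, such that for every exit pressure P_e ∈ (P₁, P₂) there exists a unique cylindrically symmetric transonic shock solution: a shock location r_s ∈ (r₁, r₂) and C¹ functions (Ū₋, ρ̄₋) on [r₁, r_s] and (Ū₊, ρ̄₊) on [r_s, r₂], together with constants S̄₋, S̄₊, κ̄, solving the ODE system (ρ̄Ū)'(r) + ρ̄Ū/r = 0 and ρ̄ŪŪ'(r) + P̄'(r) = 0 with P̄ = S̄ρ̄^γ on each interval, attaining the given data at r = r₁, satisfying the Rankine–Hugoniot conditions [ρ̄Ū](r_s) = [ρ̄Ū² + P̄](r_s) = [B̄](r_s) = 0 with the same constant κ̄ on both sides, the entropy condition S̄₊ > S̄₋, and the exit condition P̄₊(r₂) = P_e; moreover the flow is supersonic (Ū₋² > c²(ρ̄₋, S̄₋)) on [r₁, r_s) and subsonic (Ū₊² < c²(ρ̄₊,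 S̄₊)) on (r_s, r₂]. -/

import Mathlib

noncomputable section

/-- `(r_s, Ū₋, ρ̄₋, Ū₊, ρ̄₊, S̄₊)` is a cylindrically symmetric transonic shock
solution for the data `(Ū₋(r₁), ρ̄₋(r₁), S̄₋, κ̄)` and exit pressure `P_e`:
the C¹ upstream/downstream states solve the radial ODE system
`(ρ̄Ū)' + ρ̄Ū/r = 0`, `ρ̄ŪŪ' + P̄' = 0` (with `P̄ = S̄ρ̄^γ`) on `[r₁,r_s]` and
`[r_s,r₂]`, attain the incoming data, satisfy the Rankine–Hugoniot conditions
`[ρ̄Ū] = [ρ̄Ū² + P̄] = [B̄] = 0` at `r_s` (with the same constant `κ̄` on both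
sides), the entropy condition `S̄₊ > S̄₋`, the exit condition `P̄₊(r₂) = P_e`,
and are supersonic on `[r₁,r_s)` and subsonic on `(r_s,r₂]`. -/
def IsTransonicShockODE (γ r1 r2 U1m ρ1m Sm Pe : ℝ)
    (rs : ℝ) (Um ρm Up ρp : ℝ → ℝ) (Sp : ℝ) : Prop :=
  r1 < rs ∧ rs < r2 ∧
  ContDiffOn ℝ 1 Um (Set.Icc r1 rs) ∧ ContDiffOn ℝ 1 ρm (Set.Icc r1 rs) ∧
  ContDiffOn ℝ 1 Up (Set.Icc rs r2) ∧ ContDiffOn ℝ 1 ρp (Set.Icc rs r2) ∧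
  (∀ r ∈ Set.Icc r1 rs, 0 < ρm r ∧ 0 < Um r) ∧
  (∀ r ∈ Set.Icc rs r2, 0 < ρp r ∧ 0 < Up r) ∧
  (∀ r ∈ Set.Icc r1 rs,
    derivWithin (fun t => ρm t * Um t) (Set.Icc r1 rs) r + ρm r * Um r / r = 0) ∧
  (∀ r ∈ Set.Icc r1 rs,
    ρm r * Um r * derivWithin Um (Set.Icc r1 rs) r
      + derivWithin (fun t => Sm * ρm t ^ γ) (Set.Icc r1 rs) r = 0) ∧
  (∀ r ∈ Set.Icc rs r2,
    derivWithin (fun t => ρp t * Up t) (Set.Icc rs r2) r + ρp r * Up r / r = 0) ∧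
  (∀ r ∈ Set.Icc rs r2,
    ρp r * Up r * derivWithin Up (Set.Icc rs r2) r
      + derivWithin (fun t => Sp * ρp t ^ γ) (Set.Icc rs r2) r = 0) ∧
  Um r1 = U1m ∧ ρm r1 = ρ1m ∧
  -- Rankine-Hugoniot conditions at the shock r = r_s
  ρm rs * Um rs = ρp rs * Up rs ∧
  ρm rs * Um rs ^ 2 + Sm * ρm rs ^ γ = ρp rs * Up rs ^ 2 + Sp * ρp rs ^ γ ∧
  Um rs ^ 2 / 2 + γ * Sm * ρm rs ^ (γ - 1) / (γ - 1)
    = Up rs ^ 2 / 2 + γ * Sp * ρp rs ^ (γ - 1) / (γ - 1) ∧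
  -- entropy condition
  Sm < Sp ∧
  -- exit pressure
  Sp * ρp r2 ^ γ = Pe ∧
  -- supersonic upstream, subsonic downstream
  (∀ r ∈ Set.Ico r1 rs, γ * Sm * ρm r ^ (γ - 1) < Um r ^ 2) ∧
  (∀ r ∈ Set.Ioc rs r2, Up r ^ 2 < γ * Sp * ρp r ^ (γ - 1))

/-- Along a radial flow with Bernoulli constant `B`, the entropy is proportional to
`r ^ (γ - 1) * entropyProfile γ B U`. -/
def entropyProfile (γ B U : ℝ) : ℝ := U ^ (γ - 1) * (B - U ^ 2 / 2)

/-- `a` is the critical speed of a flow with Bernoulli constant `B`. -/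
structure IsCriticalSpeed (γ B a : ℝ) : Prop where
  one_lt : 1 < γ
  pos : 0 < a
  eq : (γ + 1) * a ^ 2 = 2 * (γ - 1) * B

namespace IsCriticalSpeed

variable {γ B a U V : ℝ}

theorem exists_of_pos (hγ : 1 < γ) (hB : 0 < B) : ∃ a, IsCriticalSpeed γ B a := by
  have h : 0 < 2 * (γ - 1) * B / (γ + 1) := by
    have : 0 < γ - 1 := by linarith
    positivity
  refine ⟨√(2 * (γ - 1) * B / (γ + 1)), hγ, Real.sqrt_pos.2 h, ?_⟩
  rw [Real.sq_sqrt h.le]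
  field_simp

theorem sq_lt (h : IsCriticalSpeed γ B a) : a ^ 2 < 2 * B := by
  have := h.one_lt
  have := pow_pos h.pos 2
  nlinarith [h.eq]

theorem profile_arg_pos (h : IsCriticalSpeed γ B a) (hU : 0 < U) (hUa : U ≤ a) :
    0 < B - U ^ 2 / 2 := by
  nlinarith [h.sq_lt]

theorem hasDerivAt_entropyProfile (h : IsCriticalSpeed γ B a) (hU : 0 < U) :
    HasDerivAt (entropyProfile γ B) ((γ + 1) / 2 * U ^ (γ - 1 - 1) * (a ^ 2 - U ^ 2)) U := by
  have h1 := (Real.hasDerivAt_rpow_const (x := U) (p := γ - 1) (Or.inl hU.ne')).mul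
    ((((hasDerivAt_id U).pow 2).div_const 2).const_sub B)
  have e : U ^ (γ - 1) = U ^ (γ - 1 - 1) * U := by
    rw [← Real.rpow_add_one hU.ne']; ring_nf
  refine h1.congr_deriv ?_
  simp only [id, Pi.pow_apply]
  rw [e]
  push_cast
  linear_combination (-(1 / 2) * U ^ (γ - 1 - 1)) * h.eq

theorem continuous_entropyProfile (hγ : 1 < γ) : Continuous (entropyProfile γ B) :=
  (Real.continuous_rpow_const (by linarith)).mul (by fun_prop)

theorem strictMonoOn_entropyProfile (h : IsCriticalSpeed γ B a) :
    StrictMonoOn (entropyProfile γ B) (Set.Icc 0 a) := by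
  refine strictMonoOn_of_deriv_pos (convex_Icc _ _)
    (continuous_entropyProfile h.one_lt).continuousOn fun U hU => ?_
  rw [interior_Icc] at hU
  rw [(h.hasDerivAt_entropyProfile hU.1).deriv]
  have := h.one_lt
  have := Real.rpow_pos_of_pos hU.1 (γ - 1 - 1)
  have : 0 < a ^ 2 - U ^ 2 := by nlinarith [hU.1, hU.2]
  positivity

theorem strictAntiOn_entropyProfile (h : IsCriticalSpeed γ B a) :
    StrictAntiOn (entropyProfile γ B) (Set.Ici a) := by
  refine strictAntiOn_of_deriv_neg (convex_Ici _)
    (continuous_entropyProfile h.one_lt).continuousOn fun U hU => ?_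
  rw [interior_Ici] at hU
  have hU0 : 0 < U := h.pos.trans hU
  rw [(h.hasDerivAt_entropyProfile hU0).deriv]
  have := h.one_lt
  have := Real.rpow_pos_of_pos hU0 (γ - 1 - 1)
  have : a ^ 2 - U ^ 2 < 0 := by nlinarith [h.pos, Set.mem_Ioi.1 hU]
  exact mul_neg_of_pos_of_neg (by positivity) this

theorem contDiffAt_entropyProfile (hU : 0 < U) : ContDiffAt ℝ 1 (entropyProfile γ B) U :=
  (Real.contDiffAt_rpow_const_of_ne hU.ne').mul (by fun_prop)

theorem deriv_entropyProfile_ne_zero (h : IsCriticalSpeed γ B a) (hU : 0 < U) (hUa : U ≠ a) :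
    deriv (entropyProfile γ B) U ≠ 0 := by
  rw [(h.hasDerivAt_entropyProfile hU).deriv]
  have := h.one_lt
  have h1 := Real.rpow_pos_of_pos hU (γ - 1 - 1)
  have h2 : a ^ 2 - U ^ 2 ≠ 0 := by
    rw [sq_sub_sq]
    exact mul_ne_zero (by linarith [h.pos]) (sub_ne_zero.2 hUa.symm)
  have h3 : (γ + 1) / 2 ≠ 0 := by positivity
  exact mul_ne_zero (mul_ne_zero h3 h1.ne') h2

/-- The logarithm of the entropy ratio across a normal shock, as a function of the square of
the ratio of the upstream speed to the critical speed. -/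
theorem strictMonoOn_log_shock_entropy_ratio {γ : ℝ} (hγ : 1 < γ) :
    StrictMonoOn (fun y : ℝ => Real.log ((γ + 1) / (γ - 1) - y⁻¹)
      - Real.log ((γ + 1) / (γ - 1) - y) - (γ - 1) * Real.log y)
      (Set.Ico 1 ((γ + 1) / (γ - 1))) := by
  have hg : 0 < γ - 1 := by linarith
  obtain ⟨β, hβ⟩ : ∃ β, β = (γ + 1) / (γ - 1) := ⟨_, rfl⟩
  rw [← hβ]
  have hβγ : (γ - 1) * β = γ + 1 := by rw [hβ]; field_simp
  have hβ1 : 1 < β := by nlinarith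
  have pos1 : ∀ y, 1 ≤ y → 0 < β - y⁻¹ := fun y hy => by
    have := inv_le_one_of_one_le₀ hy; linarith
  have hd : ∀ y ∈ Set.Ico 1 β, HasDerivAt (fun y : ℝ => Real.log (β - y⁻¹)
      - Real.log (β - y) - (γ - 1) * Real.log y)
      (-(-(y ^ 2)⁻¹) / (β - y⁻¹) - (-1) / (β - y) - (γ - 1) * y⁻¹) y := fun y hy => by
    have hy0 : y ≠ 0 := by linarith [hy.1]
    exact ((((hasDerivAt_inv hy0).const_sub β).log (pos1 y hy.1).ne').sub
      (((hasDerivAt_id y).const_sub β).log (by simpa using (sub_pos.2 hy.2).ne'))).sub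
      ((Real.hasDerivAt_log hy0).const_mul _)
  refine strictMonoOn_of_deriv_pos (convex_Ico _ _)
    (fun y hy => (hd y hy).continuousAt.continuousWithinAt) fun y hy => ?_
  rw [interior_Ico] at hy
  rw [(hd y ⟨hy.1.le, hy.2⟩).deriv]
  have hy0 : 0 < y := by linarith [hy.1]
  have h1 : 0 < β - y := sub_pos.2 hy.2
  have h2 : 0 < β * y - 1 := by nlinarith [hy.1]
  have key : -(-(y ^ 2)⁻¹) / (β - y⁻¹) - (-1) / (β - y) - (γ - 1) * y⁻¹
      = γ * β * (y - 1) ^ 2 / (y * (β * y - 1) * (β - y)) := by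
    have h3 : β - y⁻¹ = (β * y - 1) / y := by field_simp
    rw [h3]
    obtain ⟨d, hdef⟩ : ∃ d, d = β * y - 1 := ⟨_, rfl⟩
    rw [← hdef] at h2 ⊢
    field_simp
    rw [hdef]
    linear_combination y * (1 - β) * hβγ
  rw [key]
  have : 0 < (y - 1) ^ 2 := pow_pos (by linarith [hy.1]) 2
  positivity

theorem entropyProfile_pos (hU : 0 < U) (hUB : U ^ 2 < 2 * B) : 0 < entropyProfile γ B U :=
  mul_pos (Real.rpow_pos_of_pos hU _) (by linarith)

theorem log_entropyProfile_ratio (h : IsCriticalSpeed γ B a) (hV : a ≤ V) (hVB : V ^ 2 < 2 * B) :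
    Real.log (entropyProfile γ B (a ^ 2 / V) / entropyProfile γ B V)
      = Real.log ((γ + 1) / (γ - 1) - ((V / a) ^ 2)⁻¹)
        - Real.log ((γ + 1) / (γ - 1) - (V / a) ^ 2) - (γ - 1) * Real.log ((V / a) ^ 2) := by
  have ha := h.pos
  have hg : 0 < γ - 1 := by linarith [h.one_lt]
  have hV0 : 0 < V := ha.trans_le hV
  have hB : (γ + 1) / (γ - 1) = 2 * B / a ^ 2 := by
    rw [div_eq_div_iff hg.ne' (by positivity)]; linear_combination h.eq
  have hW : (a ^ 2 / V) ^ 2 < 2 * B := by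
    have : a ^ 2 / V ≤ a := by rw [div_le_iff₀ hV0]; nlinarith
    have h0 : 0 < a ^ 2 / V := by positivity
    nlinarith [h.sq_lt]
  have e1 : (γ + 1) / (γ - 1) - ((V / a) ^ 2)⁻¹ = 2 / a ^ 2 * (B - (a ^ 2 / V) ^ 2 / 2) := by
    rw [hB]; field_simp
  have e2 : (γ + 1) / (γ - 1) - (V / a) ^ 2 = 2 / a ^ 2 * (B - V ^ 2 / 2) := by
    rw [hB]; field_simp
  have p1 : 0 < B - (a ^ 2 / V) ^ 2 / 2 := by linarith
  have p2 : 0 < B - V ^ 2 / 2 := by linarith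
  have hW0 : 0 < a ^ 2 / V := by positivity
  have q1 := Real.rpow_pos_of_pos hW0 (γ - 1)
  have q2 := Real.rpow_pos_of_pos hV0 (γ - 1)
  have c : (2 : ℝ) / a ^ 2 ≠ 0 := by positivity
  rw [e1, e2, Real.log_mul c p1.ne', Real.log_mul c p2.ne',
    Real.log_div (entropyProfile_pos hW0 hW).ne' (entropyProfile_pos hV0 hVB).ne',
    entropyProfile, entropyProfile, Real.log_mul q1.ne' p1.ne', Real.log_mul q2.ne' p2.ne',
    Real.log_rpow hW0, Real.log_rpow hV0, Real.log_div (by positivity) hV0.ne', Real.log_pow,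
    Real.log_pow, Real.log_div hV0.ne' ha.ne']
  push_cast
  ring

theorem strictMonoOn_entropyProfile_ratio (h : IsCriticalSpeed γ B a) :
    StrictMonoOn (fun V => entropyProfile γ B (a ^ 2 / V) / entropyProfile γ B V)
      {V | a ≤ V ∧ V ^ 2 < 2 * B} := by
  intro V hV V' hV' hlt
  have ha := h.pos
  have hg : 0 < γ - 1 := by linarith [h.one_lt]
  have pos : ∀ V, a ≤ V ∧ V ^ 2 < 2 * B →
      0 < entropyProfile γ B (a ^ 2 / V) / entropyProfile γ B V := fun V hV => by
    have hV0 : 0 < V := ha.trans_le hV.1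
    have hle : a ^ 2 / V ≤ a := by rw [div_le_iff₀ hV0]; nlinarith [hV.1]
    have h0 : 0 < a ^ 2 / V := by positivity
    exact div_pos (entropyProfile_pos h0 (by nlinarith [h.sq_lt])) (entropyProfile_pos hV0 hV.2)
  have hB : (γ + 1) / (γ - 1) = 2 * B / a ^ 2 := by
    rw [div_eq_div_iff hg.ne' (by positivity)]; linear_combination h.eq
  have mem : ∀ V, a ≤ V ∧ V ^ 2 < 2 * B → (V / a) ^ 2 ∈ Set.Ico 1 ((γ + 1) / (γ - 1)) :=
    fun V hV => by
      refine ⟨one_le_pow₀ ((one_le_div ha).2 hV.1), ?_⟩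
      rw [hB, div_pow]
      exact div_lt_div_of_pos_right hV.2 (by positivity)
  refine (Real.log_lt_log_iff (pos V hV) (pos V' hV')).1 ?_
  rw [h.log_entropyProfile_ratio hV.1 hV.2, h.log_entropyProfile_ratio hV'.1 hV'.2]
  refine strictMonoOn_log_shock_entropy_ratio h.one_lt (mem V hV) (mem V' hV') ?_
  have : 0 < V / a := div_pos (ha.trans_le hV.1) ha
  gcongr

theorem entropyProfile_lt_prandtl (h : IsCriticalSpeed γ B a) (hV : a < V)
    (hVB : V ^ 2 < 2 * B) : entropyProfile γ B V < entropyProfile γ B (a ^ 2 / V) := by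
  have ha := h.pos
  have h1 := h.strictMonoOn_entropyProfile_ratio ⟨le_rfl, h.sq_lt⟩ ⟨hV.le, hVB⟩ hV
  have e : a ^ 2 / a = a := by field_simp
  simp only [e] at h1
  rwa [div_self (entropyProfile_pos ha h.sq_lt).ne',
    one_lt_div (entropyProfile_pos (ha.trans hV) hVB)] at h1

end IsCriticalSpeed

/-- A `C¹` solution branch of `f (U r) = h r`. -/
theorem exists_contDiffOn_branch {f h : ℝ → ℝ} {I J : Set ℝ} (hI : IsOpen I)
    (hf : ∀ x ∈ I, ContDiffAt ℝ 1 f x) (hf' : ∀ x ∈ I, deriv f x ≠ 0) (hinj : Set.InjOn f I)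
    (hh : ContDiffOn ℝ 1 h J) (hmem : ∀ r ∈ J, h r ∈ f '' I) :
    ∃ U : ℝ → ℝ, ContDiffOn ℝ 1 U J ∧ ∀ r ∈ J, U r ∈ I ∧ f (U r) = h r := by
  have hg : ∀ r ∈ J, Function.invFunOn f I (h r) ∈ I ∧ f (Function.invFunOn f I (h r)) = h r :=
    fun r hr => ⟨Function.invFunOn_mem (hmem r hr), Function.invFunOn_eq (hmem r hr)⟩
  refine ⟨fun r => Function.invFunOn f I (h r), fun r hr => ?_, hg⟩
  obtain ⟨hxI, hx⟩ := hg r hr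
  set x := Function.invFunOn f I (h r) with hxdef
  have hd : HasStrictDerivAt f (deriv f x) x := (hf x hxI).hasStrictDerivAt one_ne_zero
  have hs := hd.hasStrictFDerivAt_equiv (hf' x hxI)
  have hfd := hs.hasFDerivAt
  have hloc : ContDiffAt ℝ 1 ((hf x hxI).localInverse hfd one_ne_zero) (f x) :=
    (hf x hxI).to_localInverse hfd one_ne_zero
  have hlx : (hf x hxI).localInverse hfd one_ne_zero (f x) = x :=
    (hf x hxI).localInverse_apply_image hfd one_ne_zero
  have ev1 : ∀ᶠ y in nhds (f x), (hf x hxI).localInverse hfd one_ne_zero y ∈ I :=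
    hloc.continuousAt.eventually_mem (by rw [hlx]; exact hI.mem_nhds hxI)
  have ev2 : ∀ᶠ y in nhds (f x), f ((hf x hxI).localInverse hfd one_ne_zero y) = y :=
    hs.eventually_right_inverse
  have heq : Function.invFunOn f I =ᶠ[nhds (f x)]
      (hf x hxI).localInverse hfd one_ne_zero := by
    filter_upwards [ev1, ev2] with y h1 h2
    have hy : y ∈ f '' I := ⟨_, h1, h2⟩
    exact hinj (Function.invFunOn_mem hy) h1 ((Function.invFunOn_eq hy).trans h2.symm)
  have hc : ContDiffAt ℝ 1 (Function.invFunOn f I) (h r) := by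
    rw [← hx]; exact hloc.congr_of_eventuallyEq heq
  exact hc.comp_contDiffWithinAt r (hh r hr)

theorem hasDerivWithinAt_flow_invariants {γ S r : ℝ} {s : Set ℝ} {U ρ : ℝ → ℝ} (hr : 0 < r)
    (hγ : 1 < γ) (hs : UniqueDiffWithinAt ℝ s r)
    (hU : DifferentiableWithinAt ℝ U s r) (hρ : DifferentiableWithinAt ℝ ρ s r)
    (hρ0 : 0 < ρ r) :
    HasDerivWithinAt (fun t => t * (ρ t * U t))
      (r * (derivWithin (fun t => ρ t * U t) s r + ρ r * U r / r)) s r ∧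
    HasDerivWithinAt (fun t => U t ^ 2 / 2 + γ * S * ρ t ^ (γ - 1) / (γ - 1))
      ((ρ r * U r * derivWithin U s r + derivWithin (fun t => S * ρ t ^ γ) s r) / ρ r) s r := by
  have h1 := hU.hasDerivWithinAt
  have h2 := hρ.hasDerivWithinAt
  constructor
  · refine ((hasDerivWithinAt_id r s).mul (hρ.mul hU).hasDerivWithinAt).congr_deriv ?_
    change 1 * (ρ r * U r) + r * derivWithin (fun t => ρ t * U t) s r = _
    field_simp
    ring
  · have hP : HasDerivWithinAt (fun t => S * ρ t ^ γ) _ s r :=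
      (h2.rpow_const (p := γ) (Or.inl hρ0.ne')).const_mul S
    rw [hP.derivWithin hs]
    refine (((h1.pow 2).div_const 2).add (((h2.rpow_const (p := γ - 1)
      (Or.inl hρ0.ne')).const_mul (γ * S)).div_const (γ - 1))).congr_deriv ?_
    have e : ρ r ^ (γ - 1) = ρ r ^ (γ - 1 - 1) * ρ r := by
      rw [← Real.rpow_add_one hρ0.ne']; ring_nf
    have hg : γ - 1 ≠ 0 := by linarith
    rw [e]
    push_cast
    field_simp

theorem flow_invariants_eq {γ S s t : ℝ} {U ρ : ℝ → ℝ} (hγ : 1 < γ) (hs : 0 < s) (hst : s < t)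
    (hU : ContDiffOn ℝ 1 U (Set.Icc s t)) (hρ : ContDiffOn ℝ 1 ρ (Set.Icc s t))
    (hpos : ∀ r ∈ Set.Icc s t, 0 < ρ r ∧ 0 < U r)
    (hmass : ∀ r ∈ Set.Icc s t,
      derivWithin (fun t => ρ t * U t) (Set.Icc s t) r + ρ r * U r / r = 0)
    (hmom : ∀ r ∈ Set.Icc s t, ρ r * U r * derivWithin U (Set.Icc s t) r
      + derivWithin (fun t => S * ρ t ^ γ) (Set.Icc s t) r = 0) :
    ∀ r ∈ Set.Icc s t, r * (ρ r * U r) = s * (ρ s * U s) ∧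
      U r ^ 2 / 2 + γ * S * ρ r ^ (γ - 1) / (γ - 1)
        = U s ^ 2 / 2 + γ * S * ρ s ^ (γ - 1) / (γ - 1) := by
  have hd := fun r (hr : r ∈ Set.Icc s t) =>
    hasDerivWithinAt_flow_invariants (S := S) (hs.trans_le hr.1) hγ (uniqueDiffOn_Icc hst r hr)
      (hU.differentiableOn one_ne_zero r hr) (hρ.differentiableOn one_ne_zero r hr) (hpos r hr).1
  have h1 := constant_of_derivWithin_zero (fun r hr => (hd r hr).1.differentiableWithinAt)
    fun r hr => by
      have hr' := Set.Ico_subset_Icc_self hr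
      rw [(hd r hr').1.derivWithin (uniqueDiffOn_Icc hst r hr'), hmass r hr', mul_zero]
  have h2 := constant_of_derivWithin_zero (fun r hr => (hd r hr).2.differentiableWithinAt)
    fun r hr => by
      have hr' := Set.Ico_subset_Icc_self hr
      rw [(hd r hr').2.derivWithin (uniqueDiffOn_Icc hst r hr'), hmom r hr', zero_div]
  exact fun r hr => ⟨h1 r hr, h2 r hr⟩

theorem flow_of_invariants_eq {γ S s t m B : ℝ} {U ρ : ℝ → ℝ} (hγ : 1 < γ) (hs : 0 < s)
    (hst : s < t)
    (hU : ContDiffOn ℝ 1 U (Set.Icc s t)) (hρ : ContDiffOn ℝ 1 ρ (Set.Icc s t))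
    (hpos : ∀ r ∈ Set.Icc s t, 0 < ρ r)
    (hm : ∀ r ∈ Set.Icc s t, r * (ρ r * U r) = m)
    (hB : ∀ r ∈ Set.Icc s t, U r ^ 2 / 2 + γ * S * ρ r ^ (γ - 1) / (γ - 1) = B) :
    ∀ r ∈ Set.Icc s t, derivWithin (fun t => ρ t * U t) (Set.Icc s t) r + ρ r * U r / r = 0 ∧
      ρ r * U r * derivWithin U (Set.Icc s t) r
        + derivWithin (fun t => S * ρ t ^ γ) (Set.Icc s t) r = 0 := by
  intro r hr
  have hr0 : 0 < r := hs.trans_le hr.1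
  have hu := uniqueDiffOn_Icc hst r hr
  obtain ⟨h1, h2⟩ := hasDerivWithinAt_flow_invariants (S := S) hr0 hγ hu
    (hU.differentiableOn one_ne_zero r hr) (hρ.differentiableOn one_ne_zero r hr) (hpos r hr)
  have e1 := hu.eq_deriv _ h1 ((hasDerivWithinAt_const r _ m).congr hm (hm r hr))
  have e2 := hu.eq_deriv _ h2 ((hasDerivWithinAt_const r _ B).congr hB (hB r hr))
  exact ⟨(mul_eq_zero.1 e1).resolve_left hr0.ne',
    (div_eq_zero_iff.1 e2).resolve_right (hpos r hr).ne'⟩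

section State

variable {γ S B a m r U ρ : ℝ}

theorem bernoulli_eq_iff (hγ : 1 < γ) (hr : 0 < r) (hU : 0 < U) (hρ : 0 < ρ)
    (hm : r * (ρ * U) = m) :
    U ^ 2 / 2 + γ * S * ρ ^ (γ - 1) / (γ - 1) = B ↔
      γ / (γ - 1) * m ^ (γ - 1) * S = r ^ (γ - 1) * entropyProfile γ B U := by
  have hg : γ - 1 ≠ 0 := by linarith
  have h1 := Real.rpow_pos_of_pos hr (γ - 1)
  have h2 := Real.rpow_pos_of_pos hU (γ - 1)
  rw [← hm, Real.mul_rpow hr.le (by positivity), Real.mul_rpow hρ.le hU.le, entropyProfile]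
  constructor
  · intro h
    rw [← h]
    field_simp
    ring
  · intro h
    have : γ * S * ρ ^ (γ - 1) / (γ - 1) = B - U ^ 2 / 2 := by
      refine mul_left_cancel₀ (mul_pos h1 h2).ne' ?_
      rw [mul_assoc (r ^ (γ - 1)), mul_assoc (r ^ (γ - 1)), ← h]
      ring
    linarith

theorem sound_speed_sq_eq (ha : IsCriticalSpeed γ B a)
    (hB : U ^ 2 / 2 + γ * S * ρ ^ (γ - 1) / (γ - 1) = B) :
    γ * S * ρ ^ (γ - 1) = U ^ 2 + (γ + 1) / 2 * (a ^ 2 - U ^ 2) := by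
  have hg : γ - 1 ≠ 0 := by linarith [ha.one_lt]
  field_simp at hB
  linear_combination (1 / 2) * hB - (1 / 2) * ha.eq

theorem supersonic_iff (ha : IsCriticalSpeed γ B a) (hU : 0 < U)
    (hB : U ^ 2 / 2 + γ * S * ρ ^ (γ - 1) / (γ - 1) = B) :
    γ * S * ρ ^ (γ - 1) < U ^ 2 ↔ a < U := by
  have h := ha.one_lt
  rw [sound_speed_sq_eq ha hB, ← pow_lt_pow_iff_left₀ ha.pos.le hU.le two_ne_zero]
  constructor <;> intro h' <;> nlinarith

theorem subsonic_iff (ha : IsCriticalSpeed γ B a) (hU : 0 < U)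
    (hB : U ^ 2 / 2 + γ * S * ρ ^ (γ - 1) / (γ - 1) = B) :
    U ^ 2 < γ * S * ρ ^ (γ - 1) ↔ U < a := by
  have h := ha.one_lt
  rw [sound_speed_sq_eq ha hB, ← pow_lt_pow_iff_left₀ hU.le ha.pos.le two_ne_zero]
  constructor <;> intro h' <;> nlinarith

/-- The pressure at radius `r` in a flow with mass flux `m / r` and Bernoulli constant `B`. -/
def pressureOfSpeed (γ m B r U : ℝ) : ℝ := (γ - 1) / γ * (m / r) * ((B - U ^ 2 / 2) / U)

theorem pressure_eq (hγ : 1 < γ) (hr : 0 < r) (hU : 0 < U) (hρ : 0 < ρ) (hm : r * (ρ * U) = m)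
    (hB : U ^ 2 / 2 + γ * S * ρ ^ (γ - 1) / (γ - 1) = B) :
    S * ρ ^ γ = pressureOfSpeed γ m B r U := by
  have hg : γ - 1 ≠ 0 := by linarith
  have e : ρ ^ γ = ρ ^ (γ - 1) * ρ := by rw [← Real.rpow_add_one hρ.ne']; ring_nf
  rw [pressureOfSpeed, ← hB, ← hm, e]
  field_simp
  ring

theorem strictAntiOn_pressureOfSpeed (hγ : 1 < γ) (hm : 0 < m) (hB : 0 < B) (hr : 0 < r) :
    StrictAntiOn (pressureOfSpeed γ m B r) (Set.Ioi 0) := by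
  intro U hU V hV hlt
  have hU : 0 < U := hU
  have hV : 0 < V := hV
  have hg : 0 < γ - 1 := by linarith
  refine mul_lt_mul_of_pos_left ?_ (by positivity)
  rw [div_lt_div_iff₀ hV hU]
  nlinarith [mul_pos hU hV, mul_pos (mul_pos hU hV) (sub_pos.2 hlt), mul_pos hB (sub_pos.2 hlt)]

/-- Conservation of momentum across a shock amounts to Prandtl's relation. -/
theorem momentum_eq_iff {V : ℝ} (ha : IsCriticalSpeed γ B a) (hr : 0 < r) (hm : 0 < m)
    (hU : 0 < U) (hV : 0 < V) :
    m / r * U + pressureOfSpeed γ m B r U = m / r * V + pressureOfSpeed γ m B r V ↔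
      U = V ∨ U * V = a ^ 2 := by
  have hγ := ha.one_lt
  have key : (m / r * U + pressureOfSpeed γ m B r U) - (m / r * V + pressureOfSpeed γ m B r V)
      = m / r * ((γ + 1) / (2 * γ)) * ((U - V) * (U * V - a ^ 2)) / (U * V) := by
    unfold pressureOfSpeed
    field_simp
    linear_combination (U - V) * ha.eq
  rw [← sub_eq_zero, key]
  have : m / r * ((γ + 1) / (2 * γ)) ≠ 0 := by positivity
  simp [this, hU.ne', hV.ne', sub_eq_zero]

end State

section Transonic

variable {γ r1 r2 U1m ρ1m Sm Pe B a m rs Sp : ℝ} {Um ρm Up ρp : ℝ → ℝ}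

theorem IsTransonicShockODE.profile
    (h : IsTransonicShockODE γ r1 r2 U1m ρ1m Sm Pe rs Um ρm Up ρp Sp)
    (ha : IsCriticalSpeed γ B a) (hr1 : 0 < r1) (hm : r1 * (ρ1m * U1m) = m)
    (hB : U1m ^ 2 / 2 + γ * Sm * ρ1m ^ (γ - 1) / (γ - 1) = B) :
    rs ∈ Set.Ioo r1 r2 ∧
    (∀ r ∈ Set.Icc r1 rs, a ≤ Um r ∧ r * (ρm r * Um r) = m ∧
      γ / (γ - 1) * m ^ (γ - 1) * Sm = r ^ (γ - 1) * entropyProfile γ B (Um r)) ∧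
    (∀ r ∈ Set.Icc rs r2, 0 < Up r ∧ Up r ≤ a ∧ r * (ρp r * Up r) = m ∧
      γ / (γ - 1) * m ^ (γ - 1) * Sp = r ^ (γ - 1) * entropyProfile γ B (Up r)) ∧
    Um rs * Up rs = a ^ 2 ∧ pressureOfSpeed γ m B r2 (Up r2) = Pe := by
  obtain ⟨h1s, hs2, cUm, cρm, cUp, cρp, pm, pp, o1, o2, o3, o4, iU, iρ, j1, j2, j3, hS, hP,
    hsup, hsub⟩ := h
  have hγ := ha.one_lt
  have hrs : 0 < rs := hr1.trans h1s
  have mm := flow_invariants_eq hγ hr1 h1s cUm cρm pm o1 o2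
  have mp := flow_invariants_eq hγ hrs hs2 cUp cρp pp o3 o4
  have s_m : rs ∈ Set.Icc r1 rs := ⟨h1s.le, le_rfl⟩
  have s_p : rs ∈ Set.Icc rs r2 := ⟨le_rfl, hs2.le⟩
  have e_p : r2 ∈ Set.Icc rs r2 := ⟨hs2.le, le_rfl⟩
  rw [iU, iρ, hm, hB] at mm
  rw [← j1, ← j3, (mm rs s_m).1, (mm rs s_m).2] at mp
  have hm0 : 0 < m := by
    rw [← (mm rs s_m).1]; exact mul_pos hrs (mul_pos (pm rs s_m).1 (pm rs s_m).2)
  have hUa : ∀ r ∈ Set.Icc r1 rs, a ≤ Um r := by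
    have hIco : ∀ r ∈ Set.Ico r1 rs, a ≤ Um r := fun r hr =>
      have hr' := Set.Ico_subset_Icc_self hr
      ((supersonic_iff ha (pm r hr').2 (mm r hr').2).1 (hsup r hr)).le
    exact fun r hr => ContinuousWithinAt.closure_le (s := Set.Ico r1 rs)
      (by rwa [closure_Ico h1s.ne]) continuousWithinAt_const
      ((cUm.continuousOn r hr).mono Set.Ico_subset_Icc_self) hIco
  have hpr : Um rs * Up rs = a ^ 2 := by
    have q1 := pressure_eq hγ hrs (pm rs s_m).2 (pm rs s_m).1 (mm rs s_m).1 (mm rs s_m).2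
    have q2 := pressure_eq hγ hrs (pp rs s_p).2 (pp rs s_p).1 (mp rs s_p).1 (mp rs s_p).2
    have m1 : ρm rs * Um rs = m / rs := by rw [← (mm rs s_m).1]; field_simp
    have m2 : ρp rs * Up rs = m / rs := by rw [← (mp rs s_p).1]; field_simp
    have hmom : m / rs * Um rs + pressureOfSpeed γ m B rs (Um rs)
        = m / rs * Up rs + pressureOfSpeed γ m B rs (Up rs) := by
      rw [← q1, ← q2, ← m1]
      nth_rewrite 2 [j1]
      linarith
    refine ((momentum_eq_iff ha hrs hm0 (pm rs s_m).2 (pp rs s_p).2).1 hmom).resolve_left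
      fun heq => hS.ne ?_
    have hρeq : ρm rs = ρp rs := by
      rw [← heq] at j1; exact mul_right_cancel₀ (pm rs s_m).2.ne' j1
    rw [← heq, ← hρeq] at j2
    exact mul_right_cancel₀ (Real.rpow_pos_of_pos (pm rs s_m).1 γ).ne' (add_left_cancel j2)
  refine ⟨⟨h1s, hs2⟩, fun r hr => ⟨hUa r hr, (mm r hr).1, ?_⟩, fun r hr =>
    ⟨(pp r hr).2, ?_, (mp r hr).1, ?_⟩, hpr, ?_⟩
  · exact (bernoulli_eq_iff hγ (hr1.trans_le hr.1) (pm r hr).2 (pm r hr).1 (mm r hr).1).1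
      (mm r hr).2
  · rcases hr.1.eq_or_lt with rfl | hlt
    · nlinarith [hUa rs s_m, (pp rs s_p).2, ha.pos]
    · exact ((subsonic_iff ha (pp r hr).2 (mp r hr).2).1 (hsub r ⟨hlt, hr.2⟩)).le
  · exact (bernoulli_eq_iff hγ (hrs.trans_le hr.1) (pp r hr).2 (pp r hr).1 (mp r hr).1).1
      (mp r hr).2
  · rw [← hP]
    exact (pressure_eq hγ (hrs.trans hs2) (pp r2 e_p).2 (pp r2 e_p).1 (mp r2 e_p).1
      (mp r2 e_p).2).symm

theorem isTransonicShockODE_of_profile (ha : IsCriticalSpeed γ B a) (hr1 : 0 < r1) (hm0 : 0 < m)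
    (hU1 : 0 < U1m) (hm : r1 * (ρ1m * U1m) = m) (hrs : rs ∈ Set.Ioo r1 r2)
    (cUm : ContDiffOn ℝ 1 Um (Set.Icc r1 rs)) (cUp : ContDiffOn ℝ 1 Up (Set.Icc rs r2))
    (hinit : Um r1 = U1m)
    (hUm : ∀ r ∈ Set.Icc r1 rs, a < Um r ∧
      γ / (γ - 1) * m ^ (γ - 1) * Sm = r ^ (γ - 1) * entropyProfile γ B (Um r))
    (hUp : ∀ r ∈ Set.Icc rs r2, 0 < Up r ∧ Up r < a ∧
      γ / (γ - 1) * m ^ (γ - 1) * Sp = r ^ (γ - 1) * entropyProfile γ B (Up r))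
    (hS : Sm < Sp) (hpr : Um rs * Up rs = a ^ 2) (hPe : pressureOfSpeed γ m B r2 (Up r2) = Pe) :
    IsTransonicShockODE γ r1 r2 U1m ρ1m Sm Pe rs Um (fun r => m / (r * Um r)) Up
      (fun r => m / (r * Up r)) Sp := by
  obtain ⟨h1s, hs2⟩ := hrs
  have hγ := ha.one_lt
  have hrs : 0 < rs := hr1.trans h1s
  have s_m : rs ∈ Set.Icc r1 rs := ⟨h1s.le, le_rfl⟩
  have s_p : rs ∈ Set.Icc rs r2 := ⟨le_rfl, hs2.le⟩
  have e_p : r2 ∈ Set.Icc rs r2 := ⟨hs2.le, le_rfl⟩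
  have rm : ∀ r ∈ Set.Icc r1 rs, 0 < r := fun r hr => hr1.trans_le hr.1
  have rp : ∀ r ∈ Set.Icc rs r2, 0 < r := fun r hr => hrs.trans_le hr.1
  have um : ∀ r ∈ Set.Icc r1 rs, 0 < Um r := fun r hr => ha.pos.trans (hUm r hr).1
  have up : ∀ r ∈ Set.Icc rs r2, 0 < Up r := fun r hr => (hUp r hr).1
  have dm : ∀ r ∈ Set.Icc r1 rs, 0 < m / (r * Um r) := fun r hr =>
    div_pos hm0 (mul_pos (rm r hr) (um r hr))
  have dp : ∀ r ∈ Set.Icc rs r2, 0 < m / (r * Up r) := fun r hr =>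
    div_pos hm0 (mul_pos (rp r hr) (up r hr))
  have mm : ∀ r ∈ Set.Icc r1 rs, r * (m / (r * Um r) * Um r) = m := fun r hr => by
    have := rm r hr
    have := um r hr
    field_simp
  have mp : ∀ r ∈ Set.Icc rs r2, r * (m / (r * Up r) * Up r) = m := fun r hr => by
    have := rp r hr
    have := up r hr
    field_simp
  have bm := fun r hr => (bernoulli_eq_iff hγ (rm r hr) (um r hr) (dm r hr) (mm r hr)).2 (hUm r hr).2
  have bp := fun r hr =>
    (bernoulli_eq_iff hγ (rp r hr) (up r hr) (dp r hr) (mp r hr)).2 (hUp r hr).2.2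
  have cρm : ContDiffOn ℝ 1 (fun r => m / (r * Um r)) (Set.Icc r1 rs) :=
    contDiffOn_const.div (contDiffOn_id.mul cUm) fun r hr => (mul_pos (rm r hr) (um r hr)).ne'
  have cρp : ContDiffOn ℝ 1 (fun r => m / (r * Up r)) (Set.Icc rs r2) :=
    contDiffOn_const.div (contDiffOn_id.mul cUp) fun r hr => (mul_pos (rp r hr) (up r hr)).ne'
  have fm := flow_of_invariants_eq hγ hr1 h1s cUm cρm dm mm bm
  have fp := flow_of_invariants_eq hγ hrs hs2 cUp cρp dp mp bp
  have m1 : m / (rs * Um rs) * Um rs = m / rs :=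
    mul_left_cancel₀ hrs.ne' ((mm rs s_m).trans (by field_simp))
  have m2 : m / (rs * Up rs) * Up rs = m / rs :=
    mul_left_cancel₀ hrs.ne' ((mp rs s_p).trans (by field_simp))
  refine ⟨h1s, hs2, cUm, cρm, cUp, cρp, fun r hr => ⟨dm r hr, um r hr⟩,
    fun r hr => ⟨dp r hr, up r hr⟩, fun r hr => (fm r hr).1, fun r hr => (fm r hr).2,
    fun r hr => (fp r hr).1, fun r hr => (fp r hr).2, hinit, ?_, m1.trans m2.symm, ?_,
    (bm rs s_m).trans (bp rs s_p).symm, hS, ?_, fun r hr => ?_, fun r hr => ?_⟩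
  · simp only [hinit, ← hm]
    field_simp
  · have := (momentum_eq_iff ha hrs hm0 (um rs s_m) (up rs s_p)).2 (Or.inr hpr)
    rw [pressure_eq hγ hrs (um rs s_m) (dm rs s_m) (mm rs s_m) (bm rs s_m),
      pressure_eq hγ hrs (up rs s_p) (dp rs s_p) (mp rs s_p) (bp rs s_p), sq, sq, ← mul_assoc,
      ← mul_assoc, m1, m2, this]
  · rw [pressure_eq hγ (rp r2 e_p) (up r2 e_p) (dp r2 e_p) (mp r2 e_p) (bp r2 e_p), hPe]
  · have hr' := Set.Ico_subset_Icc_self hr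
    exact (supersonic_iff ha (um r hr') (bm r hr')).2 (hUm r hr').1
  · have hr' := Set.Ioc_subset_Icc_self hr
    exact (subsonic_iff ha (up r hr') (bp r hr')).2 (hUp r hr').2.1

end Transonic

theorem exists_entropyProfile_eq_sub {γ B a c : ℝ} (ha : IsCriticalSpeed γ B a) (h0 : 0 < c)
    (hc : c < entropyProfile γ B a) : c ∈ entropyProfile γ B '' Set.Ioo 0 a := by
  have hg : γ - 1 ≠ 0 := by linarith [ha.one_lt]
  refine intermediate_value_Ioo ha.pos.le
    (IsCriticalSpeed.continuous_entropyProfile ha.one_lt).continuousOn ⟨?_, hc⟩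
  simpa [entropyProfile, Real.zero_rpow hg] using h0

theorem exists_entropyProfile_eq_super {γ B a c : ℝ} (ha : IsCriticalSpeed γ B a) (h0 : 0 < c)
    (hc : c < entropyProfile γ B a) : c ∈ entropyProfile γ B '' Set.Ioo a √(2 * B) := by
  have h2B : 0 < 2 * B := (pow_pos ha.pos 2).trans ha.sq_lt
  refine intermediate_value_Ioo' (Real.le_sqrt_of_sq_le ha.sq_lt.le)
    (IsCriticalSpeed.continuous_entropyProfile ha.one_lt).continuousOn ⟨?_, hc⟩
  rw [entropyProfile, Real.sq_sqrt h2B.le]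
  simpa using h0

theorem contDiffOn_div_rpow {c p s t : ℝ} (hs : 0 < s) :
    ContDiffOn ℝ 1 (fun r : ℝ => c / r ^ p) (Set.Icc s t) := fun r hr => by
  have hr0 : 0 < r := hs.trans_le hr.1
  exact (contDiffAt_const.div (Real.contDiffAt_rpow_const_of_ne hr0.ne')
    (Real.rpow_pos_of_pos hr0 p).ne').contDiffWithinAt

/-- Proposition 1.1: given an incoming supersonic state at `r = r₁`, there exist
`0 < P₁ < P₂` (depending only on the data and `r₁, r₂`) such that for every exit
pressure `P_e ∈ (P₁,P₂)` there is a unique cylindrically symmetric transonic shock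
solution; uniqueness is of the shock position, the downstream entropy, and of the
states on their respective intervals. -/
theorem cylindrical_transonic_shock_existence_uniqueness
    (γ r1 r2 U1m ρ1m Sm κ : ℝ)
    (hγ : 1 < γ) (hr1 : 0 < r1) (hr12 : r1 < r2)
    (hU : 0 < U1m) (hρ : 0 < ρ1m) (hS : 0 < Sm)
    (hsuper : γ * Sm * ρ1m ^ (γ - 1) < U1m ^ 2) :
    ∃ P1 P2 : ℝ, 0 < P1 ∧ P1 < P2 ∧
      ∀ Pe : ℝ, P1 < Pe → Pe < P2 →
        ∃ (rs : ℝ) (Um ρm Up ρp : ℝ → ℝ) (Sp : ℝ),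
          IsTransonicShockODE γ r1 r2 U1m ρ1m Sm Pe rs Um ρm Up ρp Sp ∧
          ∀ (rs' : ℝ) (Um' ρm' Up' ρp' : ℝ → ℝ) (Sp' : ℝ),
            IsTransonicShockODE γ r1 r2 U1m ρ1m Sm Pe rs' Um' ρm' Up' ρp' Sp' →
            rs' = rs ∧ Sp' = Sp ∧
            (∀ r ∈ Set.Icc r1 rs, Um' r = Um r ∧ ρm' r = ρm r) ∧
            (∀ r ∈ Set.Icc rs r2, Up' r = Up r ∧ ρp' r = ρp r) := by
  have hg : 0 < γ - 1 := by linarith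
  obtain ⟨m, hm⟩ : ∃ m, r1 * (ρ1m * U1m) = m := ⟨_, rfl⟩
  have hm0 : 0 < m := by rw [← hm]; positivity
  obtain ⟨B, hB⟩ : ∃ B, U1m ^ 2 / 2 + γ * Sm * ρ1m ^ (γ - 1) / (γ - 1) = B := ⟨_, rfl⟩
  have hB0 : 0 < B := by
    have := Real.rpow_pos_of_pos hρ (γ - 1)
    rw [← hB]; positivity
  obtain ⟨a, ha⟩ := IsCriticalSpeed.exists_of_pos hγ hB0
  obtain ⟨K, hK⟩ : ∃ K, γ / (γ - 1) * m ^ (γ - 1) = K := ⟨_, rfl⟩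
  have hK0 : 0 < K := by
    have := Real.rpow_pos_of_pos hm0 (γ - 1)
    rw [← hK]; positivity
  have hU1a : a < U1m := (supersonic_iff ha hU hB).1 hsuper
  have hr1K : K * Sm = r1 ^ (γ - 1) * entropyProfile γ B U1m := by
    rw [← hK]; exact (bernoulli_eq_iff hγ hr1 hU hρ hm).1 hB
  have hpow : ∀ r, r1 ≤ r → 0 < r ^ (γ - 1) := fun r hr => Real.rpow_pos_of_pos (hr1.trans_le hr) _
  have hpow_mono : ∀ r s, r1 ≤ r → r ≤ s → r ^ (γ - 1) ≤ s ^ (γ - 1) := fun r s hr hs =>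
    Real.rpow_le_rpow (hr1.le.trans hr) hs hg.le
  have hanti := ha.strictAntiOn_entropyProfile
  have hmono := ha.strictMonoOn_entropyProfile
  -- the upstream flow
  obtain ⟨V, cV, hV⟩ : ∃ V : ℝ → ℝ, ContDiffOn ℝ 1 V (Set.Icc r1 r2) ∧ ∀ r ∈ Set.Icc r1 r2,
      V r ∈ Set.Ioo a √(2 * B) ∧ entropyProfile γ B (V r) = K * Sm / r ^ (γ - 1) := by
    refine exists_contDiffOn_branch isOpen_Ioo
      (fun x hx => IsCriticalSpeed.contDiffAt_entropyProfile (ha.pos.trans hx.1))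
      (fun x hx => ha.deriv_entropyProfile_ne_zero (ha.pos.trans hx.1) hx.1.ne')
      (hanti.injOn.mono fun x hx => hx.1.le) (contDiffOn_div_rpow hr1) fun r hr => ?_
    have := hpow r hr.1
    refine exists_entropyProfile_eq_super ha (by positivity) ?_
    refine lt_of_le_of_lt ?_ (hanti (Set.mem_Ici.2 le_rfl) hU1a.le hU1a)
    have h1 : K * Sm / r1 ^ (γ - 1) = entropyProfile γ B U1m := by
      rw [hr1K]; exact mul_div_cancel_left₀ _ (hpow r1 le_rfl).ne'
    rw [← h1]
    exact div_le_div_of_nonneg_left (by positivity) (hpow r1 le_rfl) (hpow_mono r1 r le_rfl hr.1)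
  have hVK : ∀ r ∈ Set.Icc r1 r2, K * Sm = r ^ (γ - 1) * entropyProfile γ B (V r) :=
    fun r hr => by rw [(hV r hr).2, mul_div_cancel₀ _ (hpow r hr.1).ne']
  have hVa : ∀ r ∈ Set.Icc r1 r2, a < V r := fun r hr => (hV r hr).1.1
  have hVB : ∀ r ∈ Set.Icc r1 r2, V r ^ 2 < 2 * B := fun r hr =>
    (Real.lt_sqrt (ha.pos.trans (hVa r hr)).le).1 (hV r hr).1.2
  have hV0 : ∀ r ∈ Set.Icc r1 r2, 0 < V r := fun r hr => ha.pos.trans (hVa r hr)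
  have m1 : r1 ∈ Set.Icc r1 r2 := ⟨le_rfl, hr12.le⟩
  have m2 : r2 ∈ Set.Icc r1 r2 := ⟨hr12.le, le_rfl⟩
  have hV_unique : ∀ r ∈ Set.Icc r1 r2, ∀ U, a ≤ U →
      K * Sm = r ^ (γ - 1) * entropyProfile γ B U → U = V r := fun r hr U hUa hUK =>
    hanti.injOn hUa (hVa r hr).le
      (mul_left_cancel₀ (hpow r hr.1).ne' (hUK.symm.trans (hVK r hr)))
  have hVmono : StrictMonoOn V (Set.Icc r1 r2) := fun r hr s hs hrs => by
    refine (hanti.lt_iff_gt (hVa s hs).le (hVa r hr).le).1 ?_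
    rw [(hV r hr).2, (hV s hs).2]
    exact div_lt_div_of_pos_left (by positivity) (hpow r hr.1)
      (Real.rpow_lt_rpow (hr1.le.trans hr.1) hrs hg)
  -- the scaled downstream entropy as a function of the shock radius
  obtain ⟨D, hD⟩ : ∃ D : ℝ → ℝ, D = fun r => r ^ (γ - 1) * entropyProfile γ B (a ^ 2 / V r) :=
    ⟨_, rfl⟩
  have hW : ∀ r ∈ Set.Icc r1 r2, a ^ 2 / V r ∈ Set.Ioo 0 a := fun r hr => by
    refine ⟨div_pos (pow_pos ha.pos 2) (hV0 r hr), ?_⟩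
    rw [div_lt_iff₀ (hV0 r hr)]
    nlinarith [hVa r hr, ha.pos]
  have hDratio : ∀ r ∈ Set.Icc r1 r2,
      D r = K * Sm * (entropyProfile γ B (a ^ 2 / V r) / entropyProfile γ B (V r)) :=
    fun r hr => by
      have := IsCriticalSpeed.entropyProfile_pos (γ := γ) (hV0 r hr) (hVB r hr)
      rw [hVK r hr, hD]; field_simp
  have hDmono : StrictMonoOn D (Set.Icc r1 r2) := fun r hr s hs hrs => by
    rw [hDratio r hr, hDratio s hs]
    exact mul_lt_mul_of_pos_left (ha.strictMonoOn_entropyProfile_ratio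
      ⟨(hVa r hr).le, hVB r hr⟩ ⟨(hVa s hs).le, hVB s hs⟩ (hVmono hr hs hrs)) (by positivity)
  have hDcont : ContinuousOn D (Set.Icc r1 r2) := by
    rw [hD]
    exact ((Real.continuous_rpow_const hg.le).continuousOn).mul
      ((IsCriticalSpeed.continuous_entropyProfile hγ).comp_continuousOn
        (continuousOn_const.div cV.continuousOn fun r hr => (hV0 r hr).ne'))
  have hDS : ∀ r ∈ Set.Icc r1 r2, K * Sm < D r := fun r hr => by
    rw [hVK r hr, hD]
    exact mul_lt_mul_of_pos_left (ha.entropyProfile_lt_prandtl (hVa r hr) (hVB r hr)) (hpow r hr.1)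
  have hDmem : ∀ r ∈ Set.Icc r1 r2, ∀ q ∈ Set.Icc r r2,
      D r / q ^ (γ - 1) ∈ entropyProfile γ B '' Set.Ioo 0 a := fun r hr q hq => by
    have hD0 : 0 < D r := lt_trans (by positivity) (hDS r hr)
    refine exists_entropyProfile_eq_sub ha (div_pos hD0 (hpow q (hr.1.trans hq.1))) ?_
    refine lt_of_le_of_lt (div_le_div_of_nonneg_left hD0.le (hpow r hr.1)
      (hpow_mono r q hr.1 hq.1)) ?_
    rw [hD]
    dsimp only
    rw [mul_div_cancel_left₀ _ (hpow r hr.1).ne']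
    exact hmono (Set.Ioo_subset_Icc_self (hW r hr)) ⟨ha.pos.le, le_rfl⟩ (hW r hr).2
  have hp2 := hpow r2 hr12.le
  obtain ⟨W1, hW1, hW1e⟩ := hDmem r1 m1 r2 m2
  obtain ⟨W2, hW2, hW2e⟩ := hDmem r2 m2 r2 ⟨le_rfl, le_rfl⟩
  have hW12 : W1 < W2 := by
    refine (hmono.lt_iff_lt (Set.Ioo_subset_Icc_self hW1) (Set.Ioo_subset_Icc_self hW2)).1 ?_
    rw [hW1e, hW2e]
    exact div_lt_div_of_pos_right (hDmono m1 m2 hr12) hp2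
  have hr2 : 0 < r2 := hr1.trans hr12
  have hQ := strictAntiOn_pressureOfSpeed hγ hm0 hB0 hr2
  refine ⟨pressureOfSpeed γ m B r2 W2, pressureOfSpeed γ m B r2 W1, ?_, hQ hW1.1 hW2.1 hW12,
    fun Pe hPe1 hPe2 => ?_⟩
  · have := ha.profile_arg_pos hW2.1 hW2.2.le
    have := hW2.1
    unfold pressureOfSpeed
    positivity
  have hQcont : ContinuousOn (pressureOfSpeed γ m B r2) (Set.Icc W1 W2) := by
    refine ContinuousOn.mul continuousOn_const (ContinuousOn.div (by fun_prop) continuousOn_id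
      fun x hx => (hW1.1.trans_le hx.1).ne')
  obtain ⟨Ue, hUe, hUePe⟩ := intermediate_value_Ioo' hW12.le hQcont ⟨hPe1, hPe2⟩
  have hUe0 : 0 < Ue := hW1.1.trans hUe.1
  have hUea : Ue < a := hUe.2.trans hW2.2
  have hDe : r2 ^ (γ - 1) * entropyProfile γ B Ue ∈ Set.Ioo (D r1) (D r2) := by
    have h1 := hmono (Set.Ioo_subset_Icc_self hW1) ⟨hUe0.le, hUea.le⟩ hUe.1
    have h2 := hmono ⟨hUe0.le, hUea.le⟩ (Set.Ioo_subset_Icc_self hW2) hUe.2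
    rw [hW1e, div_lt_iff₀ hp2] at h1
    rw [hW2e, lt_div_iff₀ hp2] at h2
    exact ⟨by linarith, by linarith⟩
  obtain ⟨rs, hrs, hDrs⟩ := intermediate_value_Ioo hr12.le hDcont hDe
  have ms := Set.Ioo_subset_Icc_self hrs
  have hrs0 : 0 < rs := hr1.trans hrs.1
  -- the downstream flow
  obtain ⟨W, cW, hWs⟩ : ∃ W : ℝ → ℝ, ContDiffOn ℝ 1 W (Set.Icc rs r2) ∧ ∀ r ∈ Set.Icc rs r2,
      W r ∈ Set.Ioo 0 a ∧ entropyProfile γ B (W r) = D rs / r ^ (γ - 1) :=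
    exists_contDiffOn_branch isOpen_Ioo
      (fun x hx => IsCriticalSpeed.contDiffAt_entropyProfile hx.1)
      (fun x hx => ha.deriv_entropyProfile_ne_zero hx.1 hx.2.ne)
      (hmono.injOn.mono Set.Ioo_subset_Icc_self) (contDiffOn_div_rpow hrs0) (hDmem rs ms)
  have hWK : ∀ r ∈ Set.Icc rs r2, D rs = r ^ (γ - 1) * entropyProfile γ B (W r) :=
    fun r hr => by rw [(hWs r hr).2, mul_div_cancel₀ _ (hpow r (ms.1.trans hr.1)).ne']
  have hW_unique : ∀ r ∈ Set.Icc rs r2, ∀ U, 0 < U → U ≤ a →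
      D rs = r ^ (γ - 1) * entropyProfile γ B U → U = W r := fun r hr U hU0 hUa hUK =>
    hmono.injOn ⟨hU0.le, hUa⟩ (Set.Ioo_subset_Icc_self (hWs r hr).1)
      (mul_left_cancel₀ (hpow r (ms.1.trans hr.1)).ne' (hUK.symm.trans (hWK r hr)))
  have sub_m : Set.Icc r1 rs ⊆ Set.Icc r1 r2 := Set.Icc_subset_Icc_right hrs.2.le
  have hWrs : a ^ 2 / V rs = W rs := hW_unique rs ⟨le_rfl, hrs.2.le⟩ _ (hW rs ms).1
    (hW rs ms).2.le (by rw [hD])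
  have hWe : Ue = W r2 := hW_unique r2 ⟨hrs.2.le, le_rfl⟩ _ hUe0 hUea.le hDrs
  have hSp : K * (D rs / K) = D rs := mul_div_cancel₀ _ hK0.ne'
  refine ⟨rs, V, fun r => m / (r * V r), W, fun r => m / (r * W r), D rs / K, ?_, ?_⟩
  · refine isTransonicShockODE_of_profile ha hr1 hm0 hU hm hrs (cV.mono sub_m) cW
      (hV_unique r1 m1 U1m hU1a.le hr1K).symm (fun r hr => ?_) (fun r hr => ?_) ?_ ?_ ?_
    · rw [hK]; exact ⟨hVa r (sub_m hr), hVK r (sub_m hr)⟩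
    · rw [hK, hSp]; exact ⟨(hWs r hr).1.1, (hWs r hr).1.2, hWK r hr⟩
    · rw [lt_div_iff₀ hK0, mul_comm]; exact hDS rs ms
    · rw [← hWrs]; exact mul_div_cancel₀ _ (hV0 rs ms).ne'
    · rw [← hWe]; exact hUePe
  · intro rs' Um' ρm' Up' ρp' Sp' h'
    obtain ⟨hrs', hm', hp', hpr', hPe'⟩ := h'.profile ha hr1 hm hB
    rw [hK] at hm' hp'
    have ms' := Set.Ioo_subset_Icc_self hrs'
    have hVrs' : Um' rs' = V rs' :=
      have h := hm' rs' ⟨ms'.1, le_rfl⟩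
      hV_unique rs' ms' _ h.1 h.2.2
    have hDrs' : K * Sp' = D rs' := by
      rw [(hp' rs' ⟨le_rfl, ms'.2⟩).2.2.2, hD]
      dsimp only
      rw [← hVrs', ← hpr', mul_div_cancel_left₀]
      rw [hVrs']
      exact (hV0 rs' ms').ne'
    have hUe' : Up' r2 = Ue :=
      hQ.injOn (hp' r2 ⟨ms'.2, le_rfl⟩).1 hUe0 (hPe'.trans hUePe.symm)
    have hDeq : D rs' = D rs := by
      rw [← hDrs', (hp' r2 ⟨ms'.2, le_rfl⟩).2.2.2, hUe', hDrs]
    obtain rfl : rs' = rs := hDmono.injOn ms' ms hDeq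
    have hρ_eq : ∀ r ρ U : ℝ, 0 < r → 0 < U → r * (ρ * U) = m → ρ = m / (r * U) :=
      fun r ρ U hr hU h => by rw [← h]; field_simp
    refine ⟨rfl, ?_, fun r hr => ?_, fun r hr => ?_⟩
    · rw [← hDrs', mul_div_cancel_left₀ _ hK0.ne']
    · obtain ⟨h1, h2, h3⟩ := hm' r hr
      have h4 := hV_unique r (sub_m hr) _ h1 h3
      exact ⟨h4, by simpa only [h4] using hρ_eq r _ _ (hr1.trans_le hr.1) (ha.pos.trans_le h1) h2⟩
    · obtain ⟨h1, h2, h3, h4⟩ := hp' r hr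
      have h5 := hW_unique r hr _ h1 h2 (hDrs'.symm.trans h4)
      exact ⟨h5, by simpa only [h5] using hρ_eq r _ _ (hrs0.trans_le hr.1) h1 h3⟩
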